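/- arXiv:math/0611643 — 3 statements merged into one kernel-verified Lean document; each statement's English description precedes it below -/
import Mathlib

section
/- Let A be a commutative noetherian local ring, C a semidualizing A-module, and x ∈ A a nonzerodivisor in A. Then the A/(x)-module C/xC is a semidualizing module over the local ring A/(x): the natural ring homomorphism A/(x) → End_{A/(x)}(C/xC) is an isomorphism and Ext^i_{A/(x)}(C/xC, C/xC) = 0 for all i > 0. -/
open CategoryTheory Opposite

/-- A finitely generated module `C` over a commutative noetherian local ring `A` is
*semidualizing* if the natural ring homomorphism `A → End_A(C)` (sending `a` to
multiplication by `a`) is an isomorphism and `Ext_A^i(C,C) = 0` for every `i > 0`. -/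
def IsSemidualizing (A : Type) [CommRing A] (C : Type) [AddCommGroup C] [Module A C] : Prop :=
  Function.Bijective (algebraMap A (Module.End A C)) ∧
  ∀ i : ℕ, 0 < i →
    Subsingleton (((Ext A (ModuleCat A) i).obj (op (ModuleCat.of A C))).obj (ModuleCat.of A C))

/-- `Y` admits a resolution `0 → C_s → ⋯ → C_0 → Y → 0` of length at most `s` in which
each `C_i` is a finite direct sum of copies of `C`. -/
def HasResolutionByOfLength (A : Type) [CommRing A] (C : Type) [AddCommGroup C] [Module A C]
    (Y : Type) [AddCommGroup Y] [Module A Y] (s : ℕ) : Prop :=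
  ∃ (n : ℕ → ℕ) (d : ∀ i : ℕ, ((Fin (n (i + 1)) → C) →ₗ[A] (Fin (n i) → C)))
    (ε : (Fin (n 0) → C) →ₗ[A] Y),
    (∀ i, s < i → n i = 0) ∧
    Function.Surjective ε ∧ Function.Exact (d 0) ε ∧
    ∀ i : ℕ, Function.Exact (d (i + 1)) (d i)

/-- `Y` has finite `C`-dimension. -/
def HasFiniteCDim (A : Type) [CommRing A] (C : Type) [AddCommGroup C] [Module A C]
    (Y : Type) [AddCommGroup Y] [Module A Y] : Prop :=
  ∃ s : ℕ, HasResolutionByOfLength A C Y s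

/-- The `C`-dimension of `Y`: the smallest `s` such that `Y` has a resolution of length `s`
by finite direct sums of copies of `C`. -/
noncomputable def cDim (A : Type) [CommRing A] (C : Type) [AddCommGroup C] [Module A C]
    (Y : Type) [AddCommGroup Y] [Module A Y] : ℕ :=
  sInf {s | HasResolutionByOfLength A C Y s}


theorem sd_bridge_aux {A : Type} [CommRing A] {X : ModuleCat.{0} A} (P : ProjectiveResolution X)
    (Y : ModuleCat.{0} A) (p : ℕ) :
    Subsingleton (((Ext A (ModuleCat A) (p+1)).obj (op X)).obj Y) ↔
    ∀ f : P.complex.X (p+1) ⟶ Y, P.complex.d (p+2) (p+1) ≫ f = 0 →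
      ∃ g : P.complex.X p ⟶ Y, P.complex.d (p+1) p ≫ g = f := by
  rw [(P.isoExt (R := A) (p+1) Y).toLinearEquiv.toEquiv.subsingleton_congr,
    ← ModuleCat.isZero_iff_subsingleton, ← HomologicalComplex.exactAt_iff_isZero_homology,
    HomologicalComplex.exactAt_iff' _ p (p+1) (p+2) (by simp) (by simp),
    ShortComplex.moduleCat_exact_iff]
  rfl

theorem sd_bridge {A : Type} [CommRing A] (X Y : ModuleCat.{0} A) (p : ℕ) :
    Subsingleton (((Ext A (ModuleCat A) (p+1)).obj (op X)).obj Y) ↔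
      Subsingleton (Abelian.Ext.{0} X Y (p+1)) := by
  obtain ⟨P⟩ := (inferInstance : HasProjectiveResolution X)
  obtain ⟨P⟩ := P
  rw [sd_bridge_aux P]
  constructor
  · intro h
    refine subsingleton_of_forall_eq 0 fun α => ?_
    obtain ⟨f, hf, rfl⟩ := P.extMk_surjective α (p+2) rfl
    exact (P.extMk_eq_zero_iff f _ rfl hf p rfl).2 (h f hf)
  · intro h f hf
    exact (P.extMk_eq_zero_iff f _ rfl hf p rfl).1 (Subsingleton.elim _ _)

section
variable {A : Type} [CommRing A] (I : Ideal A)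

abbrev SdQ (M : Type) [AddCommGroup M] [Module A M] : Type := M ⧸ (I • (⊤ : Submodule A M))

variable {M N L : Type} [AddCommGroup M] [Module A M] [AddCommGroup N] [Module A N]
  [AddCommGroup L] [Module A L]

variable [Module (A ⧸ I) N] [IsScalarTower A (A ⧸ I) N]

def sdFactor (f : M →ₗ[A] N) : SdQ I M →ₗ[A ⧸ I] N :=
  LinearMap.extendScalarsOfSurjective (R := A) Ideal.Quotient.mk_surjective
    (Submodule.liftQ _ f (by
      rw [Submodule.smul_le]
      intro r hr n _
      rw [LinearMap.mem_ker, map_smul, ← algebraMap_smul (A ⧸ I),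
        Ideal.Quotient.algebraMap_eq, Ideal.Quotient.eq_zero_iff_mem.2 hr, zero_smul]))

theorem sdFactor_mk (f : M →ₗ[A] N) (m : M) :
    sdFactor I f (Submodule.Quotient.mk m) = f m := rfl

def sdRestr (f : SdQ I M →ₗ[A ⧸ I] N) : M →ₗ[A] N :=
  (f.restrictScalars A) ∘ₗ (Submodule.mkQ _)

theorem sdRestr_apply (f : SdQ I M →ₗ[A ⧸ I] N) (m : M) :
    sdRestr I f m = f (Submodule.Quotient.mk m) := rfl

def sdMap (f : M →ₗ[A] L) : SdQ I M →ₗ[A ⧸ I] SdQ I L :=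
  sdFactor I ((Submodule.mkQ _) ∘ₗ f)

theorem sdMap_mk (f : M →ₗ[A] L) (m : M) :
    sdMap I f (Submodule.Quotient.mk m) = Submodule.Quotient.mk (f m) := rfl

theorem sd_projective [Module.Projective A M] : Module.Projective (A ⧸ I) (SdQ I M) := by
  refine Module.Projective.of_lifting_property'' fun f hf => ?_
  obtain ⟨h, hh⟩ := Module.projective_lifting_property (f.restrictScalars A)
    (Submodule.mkQ (I • (⊤ : Submodule A M))) hf
  refine ⟨sdFactor I h, LinearMap.ext fun m => ?_⟩
  obtain ⟨m, rfl⟩ := Submodule.Quotient.mk_surjective _ m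
  exact LinearMap.congr_fun hh m
end

section
variable {A : Type} [CommRing A] (x : A)
variable {M F : Type} [AddCommGroup M] [Module A M] [AddCommGroup F] [Module A F]

theorem sd_mem (m : M) : m ∈ (Ideal.span {x} • (⊤ : Submodule A M)) ↔ ∃ m', x • m' = m := by
  rw [Submodule.ideal_span_singleton_smul, Submodule.mem_smul_pointwise_iff_exists]
  simp

end

section
variable {R : Type} [CommRing R]
variable {K F M N : Type} [AddCommGroup K] [Module R K] [AddCommGroup F] [Module R F]
  [AddCommGroup M] [Module R M] [AddCommGroup N] [Module R N]

abbrev SdV (R : Type) [CommRing R] (M N : Type) [AddCommGroup M] [Module R M] [AddCommGroup N]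
    [Module R N] (n : ℕ) : Prop :=
  Subsingleton (Abelian.Ext.{0} (ModuleCat.of R M) (ModuleCat.of R N) n)

abbrev sdS (i : K →ₗ[R] F) (p : F →ₗ[R] M) (h : Function.Exact i p) :
    ShortComplex (ModuleCat.{0} R) :=
  ShortComplex.mk (ModuleCat.ofHom i) (ModuleCat.ofHom p) (by
    ext k
    exact h.apply_apply_eq_zero k)

theorem sdS_shortExact (i : K →ₗ[R] F) (p : F →ₗ[R] M) (h : Function.Exact i p)
    (hi : Function.Injective i) (hp : Function.Surjective p) : (sdS i p h).ShortExact where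
  exact := by
    rw [ShortComplex.ShortExact.moduleCat_exact_iff_function_exact]
    exact h
  mono_f := (ModuleCat.mono_iff_injective _).2 hi
  epi_g := (ModuleCat.epi_iff_surjective _).2 hp

theorem sd_ext_one (i : K →ₗ[R] F) (p : F →ₗ[R] M) (h : Function.Exact i p)
    (hi : Function.Injective i) (hp : Function.Surjective p) (hV : SdV R M N 1) (f : K →ₗ[R] N) :
    ∃ g : F →ₗ[R] N, g ∘ₗ i = f := by
  obtain ⟨g, hg⟩ := Abelian.Ext.contravariant_sequence_exact₁ (sdS_shortExact i p h hi hp)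
    (ModuleCat.of R N) (Abelian.Ext.mk₀ (ModuleCat.ofHom f)) rfl (hV.elim _ _)
  obtain ⟨g, rfl⟩ := (Abelian.Ext.mk₀_bijective _ _).2 g
  rw [Abelian.Ext.mk₀_comp_mk₀] at hg
  have := (Abelian.Ext.mk₀_bijective _ _).1 hg
  exact ⟨g.hom, congrArg ModuleCat.Hom.hom this⟩

theorem sd_ext_one' (i : K →ₗ[R] F) (p : F →ₗ[R] M) (h : Function.Exact i p)
    (hi : Function.Injective i) (hp : Function.Surjective p) [Module.Projective R F]
    (hV : ∀ f : K →ₗ[R] N, ∃ g : F →ₗ[R] N, g ∘ₗ i = f) : SdV R M N 1 := by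
  have : Projective (sdS i p h).X₂ := (IsProjective.iff_projective (R := R) F).1 inferInstance
  refine subsingleton_of_forall_eq 0 fun y => ?_
  obtain ⟨f, rfl⟩ := Abelian.Ext.contravariant_sequence_exact₃ (sdS_shortExact i p h hi hp)
    (ModuleCat.of R N) y (Abelian.Ext.eq_zero_of_projective _) (n₀ := 0) rfl
  obtain ⟨f, rfl⟩ := (Abelian.Ext.mk₀_bijective _ _).2 f
  obtain ⟨g, hg⟩ := hV f.hom
  have : f = (sdS i p h).f ≫ ModuleCat.ofHom g := by
    ext k
    exact (LinearMap.congr_fun hg k).symm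
  rw [this, ← Abelian.Ext.mk₀_comp_mk₀]
  exact (sdS_shortExact i p h hi hp).extClass_comp_assoc _

theorem sd_ext_succ (i : K →ₗ[R] F) (p : F →ₗ[R] M) (h : Function.Exact i p)
    (hi : Function.Injective i) (hp : Function.Surjective p) [Module.Projective R F] (n : ℕ) :
    SdV R M N (n + 2) ↔ SdV R K N (n + 1) := by
  have : Projective (sdS i p h).X₂ := (IsProjective.iff_projective (R := R) F).1 inferInstance
  constructor
  · intro hV
    refine subsingleton_of_forall_eq 0 fun y => ?_
    obtain ⟨z, rfl⟩ := Abelian.Ext.contravariant_sequence_exact₁ (sdS_shortExact i p h hi hp)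
      (ModuleCat.of R N) y (n₁ := n + 2) (by omega) (hV.elim _ _)
    rw [Abelian.Ext.eq_zero_of_projective z, Abelian.Ext.comp_zero]
  · intro hV
    refine subsingleton_of_forall_eq 0 fun y => ?_
    obtain ⟨z, rfl⟩ := Abelian.Ext.contravariant_sequence_exact₃ (sdS_shortExact i p h hi hp)
      (ModuleCat.of R N) y (Abelian.Ext.eq_zero_of_projective _) (n₀ := n + 1) (by omega)
    rw [hV.elim z 0, Abelian.Ext.comp_zero]

theorem sd_ext_cov (i : K →ₗ[R] F) (p : F →ₗ[R] M) (h : Function.Exact i p)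
    (hi : Function.Injective i) (hp : Function.Surjective p) (n : ℕ)
    (h1 : SdV R N F n) (h2 : SdV R N K (n + 1)) : SdV R N M n := by
  refine subsingleton_of_forall_eq 0 fun y => ?_
  obtain ⟨z, rfl⟩ := Abelian.Ext.covariant_sequence_exact₃ (ModuleCat.of R N)
    (sdS_shortExact i p h hi hp) y rfl (h2.elim _ _)
  rw [h1.elim z 0, Abelian.Ext.zero_comp]

theorem sd_ext_lift (i : K →ₗ[R] F) (p : F →ₗ[R] M) (h : Function.Exact i p)
    (hi : Function.Injective i) (hp : Function.Surjective p)
    (h2 : SdV R N K 1) (f : N →ₗ[R] M) : ∃ g : N →ₗ[R] F, p ∘ₗ g = f := by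
  obtain ⟨g, hg⟩ := Abelian.Ext.covariant_sequence_exact₃ (ModuleCat.of R N)
    (sdS_shortExact i p h hi hp) (Abelian.Ext.mk₀ (ModuleCat.ofHom f)) rfl (h2.elim _ _)
  obtain ⟨g, rfl⟩ := (Abelian.Ext.mk₀_bijective _ _).2 g
  rw [Abelian.Ext.mk₀_comp_mk₀] at hg
  have := (Abelian.Ext.mk₀_bijective _ _).1 hg
  exact ⟨g.hom, congrArg ModuleCat.Hom.hom this⟩
end


section
variable {A : Type} [CommRing A] (x : A)
variable {K F M : Type} [AddCommGroup M] [Module A M] [AddCommGroup F] [Module A F]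
  [AddCommGroup K] [Module A K]

theorem sdMap_surj (p : F →ₗ[A] M) (hp : Function.Surjective p) :
    Function.Surjective (sdMap (Ideal.span {x}) p) := by
  intro m
  obtain ⟨m, rfl⟩ := Submodule.Quotient.mk_surjective _ m
  obtain ⟨f, rfl⟩ := hp m
  exact ⟨Submodule.Quotient.mk f, rfl⟩

theorem sdMap_exact (i : K →ₗ[A] F) (p : F →ₗ[A] M) (h : Function.Exact i p)
    (hp : Function.Surjective p) :
    Function.Exact (sdMap (Ideal.span {x}) i) (sdMap (Ideal.span {x}) p) := by
  intro f
  obtain ⟨f, rfl⟩ := Submodule.Quotient.mk_surjective _ f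
  constructor
  · intro hf
    rw [sdMap_mk, Submodule.Quotient.mk_eq_zero, sd_mem] at hf
    obtain ⟨m, hm⟩ := hf
    obtain ⟨g, rfl⟩ := hp m
    obtain ⟨k, hk⟩ := (h (f - x • g)).1 (by rw [map_sub, map_smul, hm, sub_self])
    refine ⟨Submodule.Quotient.mk k, ?_⟩
    rw [sdMap_mk, hk, Submodule.Quotient.eq, sd_mem]
    exact ⟨-g, by rw [smul_neg]; abel⟩
  · rintro ⟨k, hk⟩
    obtain ⟨k, rfl⟩ := Submodule.Quotient.mk_surjective _ k
    rw [← hk, sdMap_mk, sdMap_mk, h.apply_apply_eq_zero, Submodule.Quotient.mk_zero]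

theorem sdMap_inj (i : K →ₗ[A] F) (p : F →ₗ[A] M) (h : Function.Exact i p)
    (hi : Function.Injective i) (hM : Function.Injective (fun m : M => x • m)) :
    Function.Injective (sdMap (Ideal.span {x}) i) := by
  rw [injective_iff_map_eq_zero]
  intro k hk
  obtain ⟨k, rfl⟩ := Submodule.Quotient.mk_surjective _ k
  rw [sdMap_mk, Submodule.Quotient.mk_eq_zero, sd_mem] at hk
  obtain ⟨f, hf⟩ := hk
  have h0 : p f = 0 := by
    apply hM
    change x • p f = x • 0
    rw [← map_smul, hf, h.apply_apply_eq_zero, smul_zero]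
  obtain ⟨k', rfl⟩ := (h f).1 h0
  rw [Submodule.Quotient.mk_eq_zero, sd_mem]
  exact ⟨k', hi (by rw [map_smul, hf])⟩

end

theorem sd_resolve {A : Type} [CommRing A] (x : A)
    (hx : Function.Injective (fun a : A => x * a)) (M : Type) [AddCommGroup M] [Module A M] :
    ∃ (K F : Type) (_ : AddCommGroup K) (_ : AddCommGroup F) (_ : Module A K) (_ : Module A F)
      (i : K →ₗ[A] F) (p : F →ₗ[A] M), Function.Exact i p ∧ Function.Injective i ∧
      Function.Surjective p ∧ Module.Projective A F ∧
      Function.Injective (fun k : K => x • k) := by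
  refine ⟨LinearMap.ker (Finsupp.linearCombination A (id : M → M)), M →₀ A, inferInstance,
    inferInstance, inferInstance, inferInstance, Submodule.subtype _,
    Finsupp.linearCombination A (id : M → M), ?_, Subtype.val_injective,
    Finsupp.linearCombination_id_surjective A M, inferInstance, ?_⟩
  · rw [LinearMap.exact_iff, Submodule.range_subtype]
  · intro k k' hk
    apply Subtype.ext
    ext m
    apply hx
    exact DFunLike.congr_fun (congrArg Subtype.val hk) m

theorem sd_change {A : Type} [CommRing A] (x : A) (hx : Function.Injective (fun a : A => x * a))
    (N : Type) [AddCommGroup N] [Module A N]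
    [Module (A ⧸ Ideal.span {x}) N] [IsScalarTower A (A ⧸ Ideal.span {x}) N] (n : ℕ) :
    ∀ (M : Type) [AddCommGroup M] [Module A M], Function.Injective (fun m : M => x • m) →
      SdV A M N (n + 1) → SdV (A ⧸ Ideal.span {x}) (SdQ (Ideal.span {x}) M) N (n + 1) := by
  induction n with
  | zero =>
    intro M _ _ hM hV
    obtain ⟨K, F, _, _, _, _, i, p, he, hi, hp, hF, hreg⟩ := sd_resolve x hx M
    have := sd_projective (Ideal.span {x}) (M := F)
    refine sd_ext_one' (sdMap _ i) (sdMap _ p) (sdMap_exact x i p he hp)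
      (sdMap_inj x i p he hi hM) (sdMap_surj x p hp) fun f => ?_
    obtain ⟨g, hg⟩ := sd_ext_one i p he hi hp hV (sdRestr _ f)
    refine ⟨sdFactor _ g, LinearMap.ext fun k => ?_⟩
    obtain ⟨k, rfl⟩ := Submodule.Quotient.mk_surjective _ k
    exact LinearMap.congr_fun hg k
  | succ n ih =>
    intro M _ _ hM hV
    obtain ⟨K, F, _, _, _, _, i, p, he, hi, hp, hF, hreg⟩ := sd_resolve x hx M
    have := sd_projective (Ideal.span {x}) (M := F)
    rw [sd_ext_succ (sdMap _ i) (sdMap _ p) (sdMap_exact x i p he hp)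
      (sdMap_inj x i p he hi hM) (sdMap_surj x p hp)]
    exact ih K hreg ((sd_ext_succ i p he hi hp n).1 hV)

theorem sd_regular {A : Type} [CommRing A] [IsNoetherianRing A]
    (C : Type) [AddCommGroup C] [Module A C] [Module.Finite A C]
    (hC : Function.Bijective (algebraMap A (Module.End A C)))
    (x : A) (hx : Function.Injective (fun a : A => x * a)) :
    Function.Injective (fun c : C => x • c) := by
  let K := LinearMap.ker (LinearMap.lsmul A C x)
  have h1 : Subsingleton (C →ₗ[A] K) := by
    refine subsingleton_of_forall_eq 0 fun f => ?_
    obtain ⟨a, ha⟩ := hC.2 (K.subtype ∘ₗ f)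
    have ha' : ∀ c, a • c = f c := fun c => LinearMap.congr_fun ha c
    have : x * a = x * 0 := by
      apply hC.1
      ext c
      change (x * a) • c = (x * 0) • c
      rw [mul_smul, ha', mul_zero, zero_smul]
      exact (f c).2
    have ha0 : a = 0 := hx this
    ext c
    rw [← ha', ha0, zero_smul]
    rfl
  obtain ⟨r, hr, hreg⟩ := IsSMulRegular.subsingleton_linearMap_iff.1 h1
  have hr0 : r = 0 := by
    apply hC.1
    ext c
    change r • c = (0 : A) • c
    rw [Module.mem_annihilator.1 hr c, zero_smul]
  subst hr0
  intro c d hcd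
  have hm : c - d ∈ K := by
    rw [LinearMap.mem_ker]
    change x • (c - d) = 0
    rw [smul_sub, sub_eq_zero]
    exact hcd
  have : (⟨c - d, hm⟩ : K) = 0 := hreg (by simp)
  exact sub_eq_zero.1 (congrArg Subtype.val this)

/-- If `C` is a semidualizing module over the commutative noetherian local ring `A` and
`x ∈ A` is a nonzerodivisor, then `C/xC` is a semidualizing module over `A/(x)`:
the natural map `A/(x) → End_{A/(x)}(C/xC)` is an isomorphism and
`Ext^i_{A/(x)}(C/xC, C/xC) = 0` for all `i > 0`. -/
theorem quotient_semidualizing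
    (A : Type) [CommRing A] [IsNoetherianRing A] [IsLocalRing A]
    (C : Type) [AddCommGroup C] [Module A C] [Module.Finite A C]
    (hC : IsSemidualizing A C)
    (x : A) (hx : Function.Injective (fun a : A => x * a)) :
    IsSemidualizing (A ⧸ Ideal.span {x})
      (C ⧸ (Ideal.span {x} • (⊤ : Submodule A C))) := by
  obtain ⟨hE, hV⟩ := hC
  have hreg := sd_regular C hE x hx
  have hV' : ∀ n, SdV A C C (n + 1) := fun n => (sd_bridge _ _ n).1 (hV (n + 1) n.succ_pos)
  let i : C →ₗ[A] C := LinearMap.lsmul A C x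
  let p : C →ₗ[A] SdQ (Ideal.span {x}) C := Submodule.mkQ _
  have hi : Function.Injective i := hreg
  have hp : Function.Surjective p := Submodule.mkQ_surjective _
  have he : Function.Exact i p := by
    intro c
    rw [Submodule.mkQ_apply, Submodule.Quotient.mk_eq_zero, sd_mem]
    rfl
  refine ⟨⟨?_, ?_⟩, ?_⟩
  · rw [injective_iff_map_eq_zero]
    intro a ha
    obtain ⟨a, rfl⟩ := Ideal.Quotient.mk_surjective a
    have h1 : ∀ c : C, ∃ c', x • c' = a • c := by
      intro c
      rw [← sd_mem, ← Submodule.Quotient.mk_eq_zero]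
      exact LinearMap.congr_fun ha (Submodule.Quotient.mk c)
    choose h hh using h1
    let h' : Module.End A C :=
      { toFun := h
        map_add' := fun c d => hreg (by
          change x • h (c + d) = x • (h c + h d)
          rw [smul_add, hh, hh, hh, smul_add])
        map_smul' := fun r c => hreg (by
          change x • h (r • c) = x • (r • h c)
          rw [smul_comm x r, hh, hh, smul_comm]) }
    obtain ⟨b, hb⟩ := hE.2 h'
    rw [Ideal.Quotient.eq_zero_iff_mem, Ideal.mem_span_singleton']
    refine ⟨b, hE.1 ?_⟩
    ext c
    change (b * x) • c = a • c
    rw [mul_comm, mul_smul, ← hh c]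
    congr 1
    exact LinearMap.congr_fun hb c
  · intro f
    obtain ⟨g, hg⟩ := sd_ext_lift i p he hi hp (hV' 0) (sdRestr _ f)
    obtain ⟨a, rfl⟩ := hE.2 g
    refine ⟨Ideal.Quotient.mk _ a, LinearMap.ext fun c => ?_⟩
    obtain ⟨c, rfl⟩ := Submodule.Quotient.mk_surjective _ c
    exact LinearMap.congr_fun hg c
  · intro n hn
    obtain ⟨n, rfl⟩ := Nat.exists_eq_succ_of_ne_zero hn.ne'
    refine (sd_bridge _ _ n).2 (sd_change x hx _ n C hreg ?_)
    exact sd_ext_cov i p he hi hp (n + 1) (hV' n) (hV' (n + 1))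
end

section
/- Let A be a commutative noetherian local ring, C a semidualizing A-module, and Y a nonzero finitely generated A-module of finite C-dimension. Then the Auslander–Buchsbaum identity holds: C-dim Y = depth C − depth Y. -/
open CategoryTheory Opposite

/-- The depth of a module `M` over a noetherian local ring: the length of a maximal
`M`-regular sequence of elements of the maximal ideal. -/
noncomputable def moduleDepth (A : Type) [CommRing A] [IsLocalRing A]
    (M : Type) [AddCommGroup M] [Module A M] : ℕ :=
  sSup {t | ∃ rs : List A, rs.length = t ∧
    (∀ r ∈ rs, r ∈ IsLocalRing.maximalIdeal A) ∧ RingTheory.Sequence.IsRegular M rs}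


namespace ABSemi

section res

variable {A : Type} [CommRing A] {C : Type} [AddCommGroup C] [Module A C]

lemma res_zero {Y : Type} [AddCommGroup Y] [Module A Y] (h : HasResolutionByOfLength A C Y 0) :
    ∃ n : ℕ, Nonempty ((Fin n → C) ≃ₗ[A] Y) := by
  obtain ⟨n, d, ε, hn, hε, hex, -⟩ := h
  refine ⟨n 0, ⟨LinearEquiv.ofBijective ε ⟨?_, hε⟩⟩⟩
  rw [injective_iff_map_eq_zero]
  intro x hx
  obtain ⟨y, rfl⟩ := (hex x).1 hx
  have : y = 0 := by
    funext j
    have h1 := hn 1 Nat.zero_lt_one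
    exact absurd j.2 (by simp [h1])
  simp [this]

lemma res_zero_of_equiv {Y : Type} [AddCommGroup Y] [Module A Y] {n : ℕ}
    (e : (Fin n → C) ≃ₗ[A] Y) : HasResolutionByOfLength A C Y 0 := by
  refine ⟨fun i => match i with | 0 => n | _ + 1 => 0, fun _ => 0, e.toLinearMap, ?_,
    e.surjective, ?_, ?_⟩
  · rintro (_ | i) hi
    · omega
    · rfl
  · intro x
    constructor
    · intro hx
      exact ⟨0, by simpa using (e.map_eq_zero_iff.1 hx).symm⟩
    · rintro ⟨y, rfl⟩
      simp
  · intro i x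
    constructor
    · intro _
      exact ⟨0, funext fun j => Fin.elim0 j⟩
    · rintro ⟨y, rfl⟩
      simp

lemma res_succ {Y : Type} [AddCommGroup Y] [Module A Y] {s : ℕ}
    (h : HasResolutionByOfLength A C Y (s + 1)) :
    ∃ (n : ℕ) (ε : (Fin n → C) →ₗ[A] Y), Function.Surjective ε ∧
      HasResolutionByOfLength A C (LinearMap.ker ε) s := by
  obtain ⟨n, d, ε, hn, hε, hex, hd⟩ := h
  refine ⟨n 0, ε, hε, fun i => n (i + 1), fun i => d (i + 1),
    (d 0).codRestrict _ (fun x => (hex _).2 ⟨x, rfl⟩), fun i hi => hn _ (by omega), ?_, ?_,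
    fun i => hd (i + 1)⟩
  · rintro ⟨x, hx⟩
    obtain ⟨y, hy⟩ := (hex x).1 hx
    exact ⟨y, Subtype.ext hy⟩
  · intro x
    refine Iff.trans ?_ (hd 0 x)
    exact ⟨fun h => congrArg Subtype.val h, fun h => Subtype.ext h⟩

lemma res_succ_of {Y : Type} [AddCommGroup Y] [Module A Y] {s m : ℕ}
    (ε : (Fin m → C) →ₗ[A] Y) (hε : Function.Surjective ε)
    (h : HasResolutionByOfLength A C (LinearMap.ker ε) s) :
    HasResolutionByOfLength A C Y (s + 1) := by
  obtain ⟨n, d, ε', hn, hε', hex, hd⟩ := h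
  refine ⟨fun i => match i with | 0 => m | i + 1 => n i,
    fun i => match i with
      | 0 => (LinearMap.ker ε).subtype ∘ₗ ε'
      | i + 1 => d i, ε, ?_, hε, ?_, ?_⟩
  · rintro (_ | i) hi
    · omega
    · exact hn i (by omega)
  · intro x
    constructor
    · intro hx
      obtain ⟨y, hy⟩ := hε' ⟨x, hx⟩
      exact ⟨y, by simp [hy]⟩
    · rintro ⟨y, rfl⟩
      simp
  · rintro (_ | i) x
    · refine Iff.trans ?_ (hex x)
      simp
    · exact hd i x

lemma fin_map_eq {n m : ℕ} (hs : Function.Surjective (algebraMap A (Module.End A C)))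
    (f : (Fin n → C) →ₗ[A] (Fin m → C)) :
    ∃ a : Fin m → Fin n → A, ∀ x i, f x i = ∑ j, a i j • x j := by
  choose a ha using fun (i : Fin m) (j : Fin n) =>
    hs (LinearMap.proj i ∘ₗ f ∘ₗ LinearMap.single A (fun _ => C) j)
  refine ⟨a, fun x i => ?_⟩
  have h1 : x = ∑ j, Pi.single j (x j) := (Finset.univ_sum_single x).symm
  conv_lhs => rw [h1]
  rw [map_sum, Finset.sum_apply]
  refine Finset.sum_congr rfl fun j _ => ?_
  have := LinearMap.congr_fun (ha i j) (x j)
  simpa using this.symm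

/-- insertion of a zero coordinate -/
def ins (A : Type) [CommRing A] (C : Type) [AddCommGroup C] [Module A C] {m : ℕ}
    (i : Fin (m + 1)) : (Fin m → C) →ₗ[A] (Fin (m + 1) → C) where
  toFun x := i.insertNth (α := fun _ => C) 0 x
  map_add' x y := by
    funext k
    refine Fin.succAboveCases i ?_ (fun k => ?_) k <;> simp
  map_smul' a x := by
    funext k
    refine Fin.succAboveCases i ?_ (fun k => ?_) k <;> simp

@[simp] lemma ins_same {m : ℕ} (i : Fin (m + 1)) (x : Fin m → C) : ins A C i x i = 0 := by
  simp [ins]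

@[simp] lemma ins_succAbove {m : ℕ} (i : Fin (m + 1)) (x : Fin m → C) (k : Fin m) :
    ins A C i x (i.succAbove k) = x k := by
  simp [ins]

lemma ins_of_zero {m : ℕ} (i : Fin (m + 1)) (x : Fin (m + 1) → C) (h : x i = 0) :
    ins A C i (fun k => x (i.succAbove k)) = x := by
  funext k
  refine Fin.succAboveCases i ?_ (fun k => ?_) k <;> simp [h]

lemma cancel {n m : ℕ} {Y : Type} [AddCommGroup Y] [Module A Y]
    (f : (Fin (n + 1) → C) →ₗ[A] (Fin (m + 1) → C)) (hf : Function.Injective f)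
    (ε : (Fin (m + 1) → C) →ₗ[A] Y) (hε : Function.Surjective ε) (hex : Function.Exact f ε)
    (i : Fin (m + 1)) (j : Fin (n + 1)) (u v : A) (huv : u * v = 1)
    (hu : ∀ c, f (Pi.single j c) i = u • c) :
    ∃ (f' : (Fin n → C) →ₗ[A] (Fin m → C)) (ε' : (Fin m → C) →ₗ[A] Y),
      Function.Injective f' ∧ Function.Surjective ε' ∧ Function.Exact f' ε' := by
  let q : (Fin n → C) →ₗ[A] (Fin (n + 1) → C) :=
    ins A C j - LinearMap.single A (fun _ => C) j ∘ₗ (v • (LinearMap.proj i ∘ₗ f ∘ₗ ins A C j))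
  have hq : ∀ x, q x = ins A C j x - Pi.single j (v • f (ins A C j x) i) := fun x => rfl
  have hq0 : ∀ x, f (q x) i = 0 := by
    intro x
    rw [hq, map_sub, Pi.sub_apply, hu, smul_smul, huv, one_smul, sub_self]
  have hqs : ∀ x k, q x (j.succAbove k) = x k := by
    intro x k
    simp [hq]
  let r : (Fin (m + 1) → C) →ₗ[A] (Fin m → C) := LinearMap.funLeft A C i.succAbove
  have hr : ∀ x, x i = 0 → ins A C i (r x) = x := fun x hx => ins_of_zero i x hx
  have hf' : ∀ x, ins A C i (r (f (q x))) = f (q x) := fun x => hr _ (hq0 x)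
  refine ⟨r ∘ₗ f ∘ₗ q, ε ∘ₗ ins A C i, ?_, ?_, ?_⟩
  · intro x y hxy
    have h1 : f (q x) = f (q y) := by
      rw [← hf' x, ← hf' y]
      exact congrArg _ hxy
    have h2 := hf h1
    funext k
    rw [← hqs x k, ← hqs y k, h2]
  · intro y
    obtain ⟨x, rfl⟩ := hε y
    have h0 : ∀ z, ε (f z) = 0 := fun z => (hex _).2 ⟨z, rfl⟩
    refine ⟨r (x - f (Pi.single j (v • x i))), ?_⟩
    rw [LinearMap.comp_apply, hr, map_sub, h0, sub_zero]
    rw [Pi.sub_apply, hu, smul_smul, huv, one_smul, sub_self]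
  · intro x
    constructor
    · intro hx
      obtain ⟨z, hz⟩ := (hex _).1 hx
      have hzi : f z i = 0 := by rw [hz]; simp
      refine ⟨fun k => z (j.succAbove k), ?_⟩
      have hqz : q (fun k => z (j.succAbove k)) = z := by
        have e1 : ins A C j (fun k => z (j.succAbove k)) = z - Pi.single j (z j) := by
          funext k
          refine Fin.succAboveCases j ?_ (fun k => ?_) k <;> simp
        have e2 : v • u • z j = z j := by rw [smul_smul, mul_comm, huv, one_smul]
        rw [hq, e1, map_sub, Pi.sub_apply, hu, hzi, zero_sub, smul_neg, e2, Pi.single_neg]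
        abel
      rw [LinearMap.comp_apply, LinearMap.comp_apply, hqz, hz]
      funext k
      simp [r, LinearMap.funLeft_apply]
    · rintro ⟨z, rfl⟩
      have : ins A C i (r (f (q z))) = f (q z) := hf' z
      change ε (ins A C i (r (f (q z)))) = 0
      rw [this]
      exact (hex _).2 ⟨_, rfl⟩

end res

section ext

variable {A : Type} [CommRing A] (K : ModuleCat.{0} A)

/-- functoriality of Ext in the second variable -/
noncomputable def push {M N : Type} [AddCommGroup M] [Module A M] [AddCommGroup N] [Module A N]
    (f : M →ₗ[A] N) {i : ℕ} (x : Abelian.Ext K (ModuleCat.of A M) i) :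
    Abelian.Ext K (ModuleCat.of A N) i :=
  x.comp (Abelian.Ext.mk₀ (ModuleCat.ofHom f)) (add_zero i)

variable {M N L : Type} [AddCommGroup M] [Module A M] [AddCommGroup N] [Module A N]
  [AddCommGroup L] [Module A L]

lemma push_id {i : ℕ} (x : Abelian.Ext K (ModuleCat.of A M) i) :
    push K LinearMap.id x = x := by
  simp [push]

lemma push_comp (f : M →ₗ[A] N) (g : N →ₗ[A] L) {i : ℕ}
    (x : Abelian.Ext K (ModuleCat.of A M) i) :
    push K (g ∘ₗ f) x = push K g (push K f x) := by
  simp [push]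

lemma push_zero (f : M →ₗ[A] N) (i : ℕ) :
    push K f (0 : Abelian.Ext K (ModuleCat.of A M) i) = 0 := by
  simp [push]

lemma push_smul (a : A) (f : M →ₗ[A] N) {i : ℕ} (x : Abelian.Ext K (ModuleCat.of A M) i) :
    push K (a • f) x = a • push K f x := by
  have h : ModuleCat.ofHom (a • f) = a • ModuleCat.ofHom f := rfl
  rw [push, push, h, Abelian.Ext.mk₀_smul, Abelian.Ext.comp_smul]

lemma push_sum {ι : Type} [Fintype ι] (f : ι → M →ₗ[A] N) {i : ℕ}
    (x : Abelian.Ext K (ModuleCat.of A M) i) :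
    push K (∑ j, f j) x = ∑ j, push K (f j) x := by
  let φ : (M →ₗ[A] N) →+ Abelian.Ext K (ModuleCat.of A N) i :=
    { toFun := fun f => push K f x
      map_zero' := by
        have := push_smul K (0 : A) (0 : M →ₗ[A] N) x
        simpa using this
      map_add' := fun f g => by
        simp [push, ModuleCat.ofHom_add, Abelian.Ext.mk₀_add] }
  exact map_sum φ f Finset.univ

lemma smul_eq_zero_of_ann {a : A} (ha : a ∈ Module.annihilator A K) {N : ModuleCat.{0} A} {i : ℕ}
    (x : Abelian.Ext K N i) : a • x = 0 := by
  have h : a • 𝟙 K = 0 := by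
    ext y
    exact Module.mem_annihilator.mp ha y
  have : a • x = (Abelian.Ext.mk₀ (a • 𝟙 K)).comp x (zero_add i) := by
    simp [Abelian.Ext.mk₀_smul]
  rw [this, h]
  simp

lemma sub_of_retract (f : M →ₗ[A] N) (g : N →ₗ[A] M) (h : g ∘ₗ f = LinearMap.id) {i : ℕ}
    (hs : Subsingleton (Abelian.Ext K (ModuleCat.of A N) i)) :
    Subsingleton (Abelian.Ext K (ModuleCat.of A M) i) := by
  refine subsingleton_of_forall_eq 0 fun x => ?_
  rw [← push_id K x, ← h, push_comp, Subsingleton.elim (push K f x) 0, push_zero]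

lemma sub_pi (n : ℕ) {i : ℕ} (hs : Subsingleton (Abelian.Ext K (ModuleCat.of A M) i)) :
    Subsingleton (Abelian.Ext K (ModuleCat.of A (Fin n → M)) i) := by
  refine subsingleton_of_forall_eq 0 fun x => ?_
  have h : (LinearMap.id : (Fin n → M) →ₗ[A] (Fin n → M)) =
      ∑ j, LinearMap.single A (fun _ => M) j ∘ₗ LinearMap.proj j := by
    ext j c k
    simp [Finset.sum_apply, Pi.single_apply]
  rw [← push_id K x, h, push_sum]
  refine Finset.sum_eq_zero fun j _ => ?_
  rw [push_comp, Subsingleton.elim (push K (LinearMap.proj j) x) 0, push_zero]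

lemma not_sub_pi {n : ℕ} (j : Fin n) {i : ℕ}
    (hs : ¬ Subsingleton (Abelian.Ext K (ModuleCat.of A M) i)) :
    ¬ Subsingleton (Abelian.Ext K (ModuleCat.of A (Fin n → M)) i) := by
  intro h
  refine hs (sub_of_retract K (LinearMap.single A (fun _ => M) j) (LinearMap.proj j) ?_ h)
  ext c
  simp

lemma push_minimal {n m : ℕ} (f : (Fin n → M) →ₗ[A] (Fin m → M)) (a : Fin m → Fin n → A)
    (ha : ∀ i j, a i j ∈ Module.annihilator A K) (hf : ∀ x i, f x i = ∑ j, a i j • x j)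
    {i : ℕ} (x : Abelian.Ext K (ModuleCat.of A (Fin n → M)) i) : push K f x = 0 := by
  have h : f = ∑ p : Fin m × Fin n, a p.1 p.2 •
      (LinearMap.single A (fun _ => M) p.1 ∘ₗ LinearMap.proj p.2) := by
    refine LinearMap.ext fun x => funext fun k => ?_
    rw [hf, Fintype.sum_prod_type]
    simp only [LinearMap.sum_apply, Finset.sum_apply, LinearMap.smul_apply, Pi.smul_apply,
      LinearMap.comp_apply, LinearMap.single_apply, LinearMap.proj_apply]
    rw [Finset.sum_eq_single k]
    · simp
    · intro b _ hb
      simp [hb.symm]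
    · simp
  rw [h, push_sum]
  refine Finset.sum_eq_zero fun p _ => ?_
  rw [push_smul, smul_eq_zero_of_ann K (ha _ _)]

/-- Ext-depth of `Y` is `t - s`. -/
def P (t s : ℕ) (Y : Type) [AddCommGroup Y] [Module A Y] : Prop :=
  s ≤ t ∧ (∀ i < t - s, Subsingleton (Abelian.Ext K (ModuleCat.of A Y) i)) ∧
    ¬ Subsingleton (Abelian.Ext K (ModuleCat.of A Y) (t - s))

lemma P_step {t s : ℕ} (f : M →ₗ[A] N) (g : N →ₗ[A] L) (hf : Function.Injective f)
    (hg : Function.Surjective g) (hex : Function.Exact f g)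
    (hN : ∀ i < t, Subsingleton (Abelian.Ext K (ModuleCat.of A N) i))
    (hM : P K t s M)
    (h0 : ∀ x : Abelian.Ext K (ModuleCat.of A M) (t - s), push K f x = 0) :
    P K t (s + 1) L := by
  obtain ⟨hst, hM1, hM2⟩ := hM
  let S : ShortComplex (ModuleCat.{0} A) :=
    ModuleCat.shortComplexOfCompEqZero f g hex.linearMap_comp_eq_zero
  have hS : S.ShortExact :=
    { exact := ModuleCat.shortComplex_exact _ hex
      mono_f := (ModuleCat.mono_iff_injective _).mpr hf
      epi_g := (ModuleCat.epi_iff_surjective _).mpr hg }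
  have hlt : s + 1 ≤ t := by
    by_contra hcon
    have hts : t - s = 0 := by omega
    apply hM2
    rw [hts] at h0 ⊢
    have := hS.mono_f
    have hinj := Abelian.Ext.postcomp_mk₀_injective_of_mono K S.f
    refine subsingleton_of_forall_eq 0 fun x => hinj ?_
    have e1 := h0 x
    have e2 := push_zero K f 0
    exact e1.trans e2.symm
  refine ⟨hlt, ?_, ?_⟩
  · intro i hi
    have h1 := hN i (by omega)
    have h2 := hM1 (i + 1) (by omega)
    refine subsingleton_of_forall_eq 0 fun x => ?_
    obtain ⟨y, hy⟩ := Abelian.Ext.covariant_sequence_exact₃ K hS x rfl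
      (h2.elim _ _)
    rw [← hy, h1.elim y 0]
    exact push_zero K g i
  · intro hsub
    apply hM2
    refine subsingleton_of_forall_eq 0 fun x => ?_
    obtain ⟨y, hy⟩ := Abelian.Ext.covariant_sequence_exact₁ K hS x (h0 x)
      (n₀ := t - (s + 1)) (by omega)
    rw [← hy, hsub.elim y 0]
    simp

lemma P_equiv {t s : ℕ} (e : M ≃ₗ[A] N) (h : P K t s M) : P K t s N := by
  obtain ⟨h1, h2, h3⟩ := h
  refine ⟨h1, fun i hi => sub_of_retract K e.symm.toLinearMap e.toLinearMap (by ext; simp)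
    (h2 i hi), fun h => h3 ?_⟩
  exact sub_of_retract K e.toLinearMap e.symm.toLinearMap (by ext; simp) h

end ext

section main

variable {A : Type} [CommRing A] [IsLocalRing A] {C : Type} [AddCommGroup C] [Module A C]
  (K : ModuleCat.{0} A)

lemma len_one (hK : IsLocalRing.maximalIdeal A ≤ Module.annihilator A K)
  (hs : Function.Surjective (algebraMap A (Module.End A C)))
  {t : ℕ} (hC : P K t 0 C) {Y : Type} [AddCommGroup Y] [Module A Y] (n : ℕ) :
    ∀ (m : ℕ) (f : (Fin n → C) →ₗ[A] (Fin m → C)) (ε : (Fin m → C) →ₗ[A] Y),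
    Function.Injective f → Function.Surjective ε → Function.Exact f ε →
    P K t 1 Y ∨ HasResolutionByOfLength A C Y 0 := by
  induction n with
  | zero =>
    intro m f ε hf hε hex
    right
    refine res_zero_of_equiv (LinearEquiv.ofBijective ε ⟨?_, hε⟩)
    rw [injective_iff_map_eq_zero]
    intro x hx
    obtain ⟨y, rfl⟩ := (hex x).1 hx
    rw [Subsingleton.elim y 0, map_zero]
  | succ n ih =>
    intro m f ε hf hε hex
    obtain ⟨a, ha⟩ := fin_map_eq hs f
    by_cases hm : ∀ i j, a i j ∈ IsLocalRing.maximalIdeal A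
    · left
      refine P_step K f ε hf hε hex (fun i hi => sub_pi K m (hC.2.1 i hi))
        ⟨hC.1, fun i hi => sub_pi K _ (hC.2.1 i hi), not_sub_pi K 0 hC.2.2⟩ fun x => ?_
      exact push_minimal K f a (fun i j => hK (hm i j)) ha x
    · push Not at hm
      obtain ⟨i, j, hij⟩ := hm
      have hu : IsUnit (a i j) := by simpa using hij
      obtain ⟨v, hv⟩ := hu.exists_right_inv
      obtain _ | m := m
      · exact Fin.elim0 i
      obtain ⟨f', ε', h1, h2, h3⟩ := cancel f hf ε hε hex i j (a i j) v hv (fun c => by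
        rw [ha, Finset.sum_eq_single j]
        · simp
        · intro b _ hb
          simp [hb]
        · simp)
      exact ih m f' ε' h1 h2 h3

lemma main_step (hK : IsLocalRing.maximalIdeal A ≤ Module.annihilator A K)
  (hs : Function.Surjective (algebraMap A (Module.End A C)))
  {t : ℕ} (hC : P K t 0 C) (s : ℕ) :
    ∀ (Y : Type) [AddCommGroup Y] [Module A Y] [Nontrivial Y],
    HasResolutionByOfLength A C Y s →
    P K t s Y ∨ ∃ s' < s, HasResolutionByOfLength A C Y s' := by
  induction s with
  | zero =>
    intro Y _ _ _ h
    left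
    obtain ⟨n, ⟨e⟩⟩ := res_zero h
    refine P_equiv K e ?_
    obtain _ | n := n
    · exact absurd e.symm.toEquiv.subsingleton (not_subsingleton Y)
    · exact ⟨hC.1, fun i hi => sub_pi K _ (hC.2.1 i hi), not_sub_pi K 0 hC.2.2⟩
  | succ s ih =>
    intro Y _ _ _ h
    obtain ⟨m, ε, hε, hk⟩ := res_succ h
    rcases subsingleton_or_nontrivial (LinearMap.ker ε) with hsub | hnon
    · right
      refine ⟨0, by omega, res_zero_of_equiv (LinearEquiv.ofBijective ε ⟨?_, hε⟩)⟩
      rw [← LinearMap.ker_eq_bot]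
      exact (Submodule.subsingleton_iff_eq_bot).1 hsub
    obtain _ | s := s
    · obtain ⟨n, ⟨e⟩⟩ := res_zero hk
      rcases len_one K hK hs hC n m ((LinearMap.ker ε).subtype ∘ₗ e.toLinearMap) ε
        ((Submodule.injective_subtype _).comp e.injective) hε (by
          intro x
          constructor
          · intro hx
            exact ⟨e.symm ⟨x, hx⟩, by simp⟩
          · rintro ⟨y, rfl⟩
            simp) with h | h
      · exact Or.inl h
      · exact Or.inr ⟨0, by omega, h⟩
    · rcases ih (LinearMap.ker ε) hk with h | ⟨s', hs', h⟩
      · left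
        refine P_step K (LinearMap.ker ε).subtype ε (Submodule.injective_subtype _) hε
          (LinearMap.exact_subtype_ker_map ε) (fun i hi => sub_pi K m (hC.2.1 i hi)) h fun x => ?_
        have hts := h.1
        exact (sub_pi K m (hC.2.1 (t - (s + 1)) (by omega))).elim _ _
      · exact Or.inr ⟨s' + 1, by omega, res_succ_of ε hε h⟩

end main

section depth

variable (A : Type) [CommRing A] [IsNoetherianRing A] [IsLocalRing A]

/-- the residue field -/
noncomputable abbrev kk : ModuleCat.{0} A :=
  ModuleCat.of A (Shrink.{0} (A ⧸ IsLocalRing.maximalIdeal A))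

lemma kk_ann : IsLocalRing.maximalIdeal A ≤ Module.annihilator A (kk A) := by
  have := (Shrink.linearEquiv.{0} A (A ⧸ IsLocalRing.maximalIdeal A)).annihilator_eq
  change _ ≤ Module.annihilator A (Shrink.{0} (A ⧸ IsLocalRing.maximalIdeal A))
  rw [this, Ideal.annihilator_quotient]

variable (M : Type) [AddCommGroup M] [Module A M] [Module.Finite A M] [Nontrivial M]

lemma reg_iff (n : ℕ) : (∃ rs : List A, rs.length = n ∧
    (∀ r ∈ rs, r ∈ IsLocalRing.maximalIdeal A) ∧ RingTheory.Sequence.IsRegular M rs) ↔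
    ∀ i < n, Subsingleton (Abelian.Ext (kk A) (ModuleCat.of A M) i) := by
  have hlt : IsLocalRing.maximalIdeal A • (⊤ : Submodule A M) < ⊤ :=
    (Submodule.top_ne_ideal_smul_of_le_jacobson_annihilator
      (IsLocalRing.maximalIdeal_le_jacobson _)).symm.lt_top
  exact ((ModuleCat.exists_isRegular_tfae (IsLocalRing.maximalIdeal A) n
    (ModuleCat.of A M) hlt).out 1 3).symm

lemma depth_eq (d : ℕ) (h1 : ∀ i < d, Subsingleton (Abelian.Ext (kk A) (ModuleCat.of A M) i))
    (h2 : ¬ Subsingleton (Abelian.Ext (kk A) (ModuleCat.of A M) d)) : moduleDepth A M = d := by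
  have : {t | ∃ rs : List A, rs.length = t ∧
    (∀ r ∈ rs, r ∈ IsLocalRing.maximalIdeal A) ∧ RingTheory.Sequence.IsRegular M rs} =
      Set.Iic d := by
    ext t
    rw [Set.mem_ofPred_eq, reg_iff, Set.mem_Iic]
    constructor
    · intro h
      by_contra hc
      exact h2 (h d (by omega))
    · intro h i hi
      exact h1 i (by omega)
  rw [moduleDepth, this, csSup_Iic]

lemma exists_ext : ∃ d, ¬ Subsingleton (Abelian.Ext (kk A) (ModuleCat.of A M) d) := by
  by_contra hc
  push Not at hc
  have h1 := ringKrullDim_ne_top (R := A)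
  have h2 := ringKrullDim_ne_bot (R := A)
  obtain ⟨n, hn⟩ : ∃ n : ℕ, ringKrullDim A = n := by
    lift ringKrullDim A to ℕ∞ using h2 with d
    lift d to ℕ using (fun h => h1 (by rw [h]; rfl)) with n
    exact ⟨n, rfl⟩
  obtain ⟨rs, hlen, -, hreg⟩ := (reg_iff A M (n + 1)).2 fun i _ => hc i
  have h := Module.supportDim_add_length_eq_supportDim_of_isRegular rs hreg
  have h3 := Module.supportDim_le_ringKrullDim A M
  have hnt : Nontrivial (M ⧸ Ideal.ofList rs • (⊤ : Submodule A M)) :=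
    Submodule.Quotient.nontrivial_iff.mpr hreg.2.symm
  have h4 := Module.supportDim_ne_bot_of_nontrivial A (M ⧸ Ideal.ofList rs • (⊤ : Submodule A M))
  rw [← h, hn, hlen] at h3
  generalize Module.supportDim A (M ⧸ Ideal.ofList rs • (⊤ : Submodule A M)) = D at h3 h4
  lift D to ℕ∞ using h4
  have h5 : D + ((n + 1 : ℕ) : ℕ∞) ≤ (n : ℕ∞) := by exact_mod_cast h3
  have h6 : ((n + 1 : ℕ) : ℕ∞) ≤ (n : ℕ∞) := le_trans le_add_self h5
  have h7 : n + 1 ≤ n := by exact_mod_cast h6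
  omega

end depth

end ABSemi

/-- The Auslander–Buchsbaum identity for a semidualizing module `C`: if `Y` is a nonzero
finitely generated module of finite `C`-dimension, then
`C-dim Y = depth C − depth Y`. -/
theorem auslander_buchsbaum_for_semidualizing
    (A : Type) [CommRing A] [IsNoetherianRing A] [IsLocalRing A]
    (C : Type) [AddCommGroup C] [Module A C] [Module.Finite A C]
    (hC : IsSemidualizing A C)
    (Y : Type) [AddCommGroup Y] [Module A Y] [Module.Finite A Y] [Nontrivial Y]
    (hY : HasFiniteCDim A C Y) :
    (cDim A C Y : ℤ) = (moduleDepth A C : ℤ) - (moduleDepth A Y : ℤ) := by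
  have hCn : Nontrivial C := by
    by_contra h
    rw [not_nontrivial_iff_subsingleton] at h
    have : Subsingleton (Module.End A C) := inferInstance
    exact not_subsingleton A hC.1.1.subsingleton
  classical
  have hex := ABSemi.exists_ext A C
  have ht1 := Nat.find_spec hex
  have ht2 : ∀ i < Nat.find hex, _ := fun i hi => not_not.1 (Nat.find_min hex hi)
  have hCd := ABSemi.depth_eq A C _ ht2 ht1
  have hmem : HasResolutionByOfLength A C Y (cDim A C Y) := Nat.sInf_mem hY
  rcases ABSemi.main_step (ABSemi.kk A) (ABSemi.kk_ann A) hC.1.2 (t := Nat.find hex)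
    ⟨Nat.zero_le _, ht2, ht1⟩ _ Y hmem with h | ⟨s', hs', h⟩
  · have hYd := ABSemi.depth_eq A Y _ h.2.1 h.2.2
    have := h.1
    rw [hCd, hYd]
    omega
  · exact absurd (Nat.sInf_le h) (not_le.2 hs')
end

section
/- Let A be a commutative noetherian local ring and C a semidualizing A-module. Then depth C = depth A, and for every finitely generated A-module Y of finite C-dimension one has depth Y = depth Hom_A(C,Y). -/
open CategoryTheory Opposite

/-- All positive `Ext` groups from `C` to `Y` vanish. -/
def ExtVanish (A : Type) [CommRing A] (C : Type) [AddCommGroup C] [Module A C]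
    (Y : Type) [AddCommGroup Y] [Module A Y] : Prop :=
  ∀ i : ℕ, 0 < i → Subsingleton (Abelian.Ext (ModuleCat.of A C) (ModuleCat.of A Y) i)

section
variable {A : Type} [CommRing A] {C : Type} [AddCommGroup C] [Module A C]

lemma lift_of_ext_old (P : ProjectiveResolution (ModuleCat.of A C)) (Y : ModuleCat.{0} A) (n : ℕ)
    (h : Subsingleton (((Ext A (ModuleCat A) (n + 1)).obj (op (ModuleCat.of A C))).obj Y))
    (f : P.complex.X (n + 1) ⟶ Y) (hf : P.complex.d (n + 2) (n + 1) ≫ f = 0) :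
    ∃ g : P.complex.X n ⟶ Y, P.complex.d (n + 1) n ≫ g = f := by
  have h0 : Limits.IsZero ((P.complex.linearYonedaObj A Y).homology (n + 1)) :=
    Limits.IsZero.of_iso (ModuleCat.isZero_of_subsingleton _) (P.isoExt (R := A) (n + 1) Y).symm
  rw [← HomologicalComplex.exactAt_iff_isZero_homology,
    HomologicalComplex.exactAt_iff' _ n (n + 1) (n + 2) (by simp) (by simp),
    ShortComplex.moduleCat_exact_iff] at h0
  exact h0 f hf

lemma extVanish_pi_of_old
    (h : ∀ i : ℕ, 0 < i →
      Subsingleton (((Ext A (ModuleCat A) i).obj (op (ModuleCat.of A C))).obj (ModuleCat.of A C)))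
    (m : ℕ) : ExtVanish A C (Fin m → C) := by
  intro i hi
  obtain ⟨n, rfl⟩ : ∃ n, i = n + 1 := ⟨i - 1, by omega⟩
  let P := projectiveResolution (ModuleCat.of A C)
  refine subsingleton_of_forall_eq 0 fun α => ?_
  obtain ⟨f, hf, rfl⟩ := P.extMk_surjective α (n + 2) rfl
  rw [P.extMk_eq_zero_iff _ _ _ _ n rfl]
  have key : ∀ j : Fin m, ∃ g : P.complex.X n ⟶ ModuleCat.of A C,
      P.complex.d (n + 1) n ≫ g = f ≫ ModuleCat.ofHom (LinearMap.proj j) := fun j =>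
    lift_of_ext_old P _ n (h _ hi) _ (by rw [← Category.assoc, hf, Limits.zero_comp])
  choose g hg using key
  refine ⟨ModuleCat.ofHom (LinearMap.pi fun j => (g j).hom), ?_⟩
  ext x j
  have := congrArg (fun t => t.hom x) (hg j)
  simpa using this

lemma extVanish_of_surjective {L Y : Type} [AddCommGroup L] [Module A L] [AddCommGroup Y]
    [Module A Y] (f : L →ₗ[A] Y) (hf : Function.Surjective f)
    (hL : ExtVanish A C L) (hK : ExtVanish A C (LinearMap.ker f)) : ExtVanish A C Y := by
  intro i hi
  refine subsingleton_of_forall_eq 0 fun α => ?_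
  have h1 := hK (i + 1) (by omega)
  have h2 := hL i hi
  obtain ⟨β, hβ⟩ := Abelian.Ext.covariant_sequence_exact₃ (ModuleCat.of A C)
    (LinearMap.shortExact_shortComplexKer hf) α rfl
    (@Subsingleton.elim (Abelian.Ext (ModuleCat.of A C) (ModuleCat.of A (LinearMap.ker f)) (i + 1))
      h1 _ _)
  have hβ0 : β = 0 :=
    @Subsingleton.elim (Abelian.Ext (ModuleCat.of A C) (ModuleCat.of A L) i) h2 _ _
  rw [← hβ, hβ0]
  exact Abelian.Ext.zero_comp ..

lemma extVanish_of_subsingleton {Y : Type} [AddCommGroup Y] [Module A Y] [Subsingleton Y] :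
    ExtVanish A C Y := by
  intro i _
  refine subsingleton_of_forall_eq 0 fun α => ?_
  have h : 𝟙 (ModuleCat.of A Y) = 0 :=
    (ModuleCat.isZero_of_subsingleton (ModuleCat.of A Y)).eq_of_src _ _
  rw [← Abelian.Ext.comp_mk₀_id α, h, Abelian.Ext.mk₀_zero, Abelian.Ext.comp_zero]

lemma extVanish_of_resolution (hC : ∀ m : ℕ, ExtVanish A C (Fin m → C)) (s : ℕ) :
    ∀ (Y : Type) [AddCommGroup Y] [Module A Y] (n : ℕ → ℕ)
    (d : ∀ i : ℕ, ((Fin (n (i + 1)) → C) →ₗ[A] (Fin (n i) → C)))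
    (ε : (Fin (n 0) → C) →ₗ[A] Y), (∀ i, s ≤ i → n i = 0) →
    Function.Surjective ε → Function.Exact (d 0) ε → (∀ i : ℕ, Function.Exact (d (i + 1)) (d i)) →
    ExtVanish A C Y := by
  induction s with
  | zero =>
    intro Y _ _ n d ε hn hε _ _
    have : IsEmpty (Fin (n 0)) := by rw [hn 0 le_rfl]; infer_instance
    have : Subsingleton Y := hε.subsingleton
    exact extVanish_of_subsingleton
  | succ s ih =>
    intro Y _ _ n d ε hn hε h0 hd
    refine extVanish_of_surjective ε hε (hC _) ?_
    refine ih (LinearMap.ker ε) (fun i => n (i + 1)) (fun i => d (i + 1))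
      ((d 0).codRestrict (LinearMap.ker ε) fun x => h0.apply_apply_eq_zero x)
      (fun i hi => hn _ (by omega)) ?_ ?_ (fun i => hd (i + 1))
    · rintro ⟨y, hy⟩
      obtain ⟨x, hx⟩ := (h0 y).mp hy
      exact ⟨x, Subtype.ext hx⟩
    · intro x
      rw [← hd 0 x]
      exact Subtype.ext_iff

variable {Y : Type} [AddCommGroup Y] [Module A Y]

lemma extVanish_quotSMulTop (hY : ExtVanish A C Y) {x : A} (hx : IsSMulRegular Y x) :
    ExtVanish A C (QuotSMulTop x Y) := by
  intro i hi
  refine subsingleton_of_forall_eq 0 fun α => ?_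
  have h1 := hY (i + 1) (by omega)
  have h2 := hY i hi
  obtain ⟨β, hβ⟩ := Abelian.Ext.covariant_sequence_exact₃ (ModuleCat.of A C)
    (IsSMulRegular.smulShortComplex_shortExact (M := ModuleCat.of A Y) hx) α rfl
    (@Subsingleton.elim (Abelian.Ext (ModuleCat.of A C) (ModuleCat.of A Y) (i + 1)) h1 _ _)
  have hβ0 : β = 0 :=
    @Subsingleton.elim (Abelian.Ext (ModuleCat.of A C) (ModuleCat.of A Y) i) h2 _ _
  rw [← hβ, hβ0]
  exact Abelian.Ext.zero_comp ..

lemma exists_lift_quot (hY : ExtVanish A C Y) {x : A} (hx : IsSMulRegular Y x)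
    (f : C →ₗ[A] QuotSMulTop x Y) :
    ∃ g : C →ₗ[A] Y, (Submodule.mkQ _).comp g = f := by
  have h1 := hY 1 (by omega)
  obtain ⟨β, hβ⟩ := Abelian.Ext.covariant_sequence_exact₃ (ModuleCat.of A C)
    (IsSMulRegular.smulShortComplex_shortExact (M := ModuleCat.of A Y) hx)
    (Abelian.Ext.mk₀ (ModuleCat.ofHom f)) (zero_add 1)
    (@Subsingleton.elim (Abelian.Ext (ModuleCat.of A C) (ModuleCat.of A Y) 1) h1 _ _)
  obtain ⟨g, rfl⟩ := (Abelian.Ext.mk₀_bijective _ _).2 β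
  rw [Abelian.Ext.mk₀_comp_mk₀] at hβ
  have := (Abelian.Ext.mk₀_bijective _ _).1 hβ
  exact ⟨g.hom, congrArg (fun t => t.hom) this⟩

open Pointwise in
lemma nonempty_quotHom (hY : ExtVanish A C Y) {x : A} (hx : IsSMulRegular Y x) :
    Nonempty (QuotSMulTop x (C →ₗ[A] Y) ≃ₗ[A] (C →ₗ[A] QuotSMulTop x Y)) := by
  let φ : (C →ₗ[A] Y) →ₗ[A] (C →ₗ[A] QuotSMulTop x Y) :=
    LinearMap.llcomp A C Y (QuotSMulTop x Y) (Submodule.mkQ _)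
  have hφ : Function.Surjective φ := fun f => exists_lift_quot hY hx f
  have hker : LinearMap.ker φ = x • (⊤ : Submodule A (C →ₗ[A] Y)) := by
    ext f
    rw [LinearMap.mem_ker, Submodule.mem_smul_pointwise_iff_exists]
    constructor
    · intro hf
      have : ∀ c, ∃ y, x • y = f c := by
        intro c
        have h := LinearMap.congr_fun hf c
        have h' : f c ∈ x • (⊤ : Submodule A Y) := (Submodule.Quotient.mk_eq_zero _).mp h
        obtain ⟨y, -, hy⟩ := (Submodule.mem_smul_pointwise_iff_exists _ _ _).mp h'
        exact ⟨y, hy⟩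
      choose g hg using this
      refine ⟨{ toFun := g, map_add' := ?_, map_smul' := ?_ }, trivial, ?_⟩
      · intro a b
        apply hx
        simp only [smul_add, hg, map_add]
      · intro r a
        apply hx
        simp only [RingHom.id_apply]
        rw [smul_comm x r, hg, hg, map_smul]
      · ext c
        exact hg c
    · rintro ⟨g, -, rfl⟩
      ext c
      refine (Submodule.Quotient.mk_eq_zero _).mpr ?_
      exact Submodule.smul_mem_pointwise_smul _ _ _ trivial
  exact ⟨(Submodule.quotEquivOfEq _ _ hker.symm).trans (φ.quotKerEquivOfSurjective hφ)⟩

lemma isSMulRegular_hom {x : A} (hx : IsSMulRegular Y x) : IsSMulRegular (C →ₗ[A] Y) x := by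
  intro f g h
  ext c
  exact hx (LinearMap.congr_fun h c)

end

section Local
set_option linter.unusedSectionVars false
variable {A : Type} [CommRing A] [IsLocalRing A] [IsNoetherianRing A]

/-- There is an `M`-regular sequence of length `t` in the maximal ideal. -/
def RegLen (A : Type) [CommRing A] [IsLocalRing A]
    (M : Type) [AddCommGroup M] [Module A M] (t : ℕ) : Prop :=
  ∃ rs : List A, rs.length = t ∧
    (∀ r ∈ rs, r ∈ IsLocalRing.maximalIdeal A) ∧ RingTheory.Sequence.IsRegular M rs


lemma RegLen.congr {M N : Type} [AddCommGroup M] [Module A M] [AddCommGroup N] [Module A N]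
    (e : M ≃ₗ[A] N) (t : ℕ) : RegLen A M t ↔ RegLen A N t := by
  simp only [RegLen, e.isRegular_congr]


lemma RegLen.nontrivial {M : Type} [AddCommGroup M] [Module A M] {t : ℕ} (h : RegLen A M t) :
    Nontrivial M := by
  obtain ⟨rs, -, -, h⟩ := h
  exact h.nontrivial


lemma RegLen.cons {M : Type} [AddCommGroup M] [Module A M] {t : ℕ} {x : A}
    (hx : x ∈ IsLocalRing.maximalIdeal A) (hr : IsSMulRegular M x)
    (h : RegLen A (QuotSMulTop x M) t) : RegLen A M (t + 1) := by
  obtain ⟨rs, h1, h2, h3⟩ := h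
  exact ⟨x :: rs, by simp [h1], List.forall_mem_cons.mpr ⟨hx, h2⟩, h3.cons hr⟩


lemma RegLen.exists_quot {M : Type} [AddCommGroup M] [Module A M] {t : ℕ}
    (h : RegLen A M (t + 1)) : ∃ x ∈ IsLocalRing.maximalIdeal A, IsSMulRegular M x ∧
      RegLen A (QuotSMulTop x M) t := by
  obtain ⟨rs, h1, h2, h3⟩ := h
  match rs with
  | [] => simp at h1
  | x :: rs =>
    rw [RingTheory.Sequence.isRegular_cons_iff] at h3
    exact ⟨x, h2 x (by simp), h3.1, rs, by simpa using h1,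
      fun r hr => h2 r (by simp [hr]), h3.2⟩


lemma smul_top_lt {M : Type} [AddCommGroup M] [Module A M] [Module.Finite A M] [Nontrivial M]
    {I : Ideal A} (hI : I ≤ IsLocalRing.maximalIdeal A) : I • (⊤ : Submodule A M) < ⊤ :=
  lt_top_iff_ne_top.mpr (Submodule.top_ne_ideal_smul_of_le_jacobson_annihilator
    (hI.trans (IsLocalRing.maximalIdeal_le_jacobson _))).symm

lemma RegLen.iff_ext {M : Type} [AddCommGroup M] [Module A M] [Module.Finite A M] [Nontrivial M]
    (t : ℕ) : RegLen A M t ↔ ∀ i < t, Subsingleton (Abelian.Ext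
      (ModuleCat.of A (Shrink.{0} (A ⧸ IsLocalRing.maximalIdeal A))) (ModuleCat.of A M) i) :=
  ((ModuleCat.exists_isRegular_tfae (IsLocalRing.maximalIdeal A) t (ModuleCat.of A M)
    (smul_top_lt le_rfl)).out 1 3).symm

lemma RegLen.quot {M : Type} [AddCommGroup M] [Module A M] [Module.Finite A M]
    {t : ℕ} (h : RegLen A M (t + 1)) {x : A} (hx : x ∈ IsLocalRing.maximalIdeal A)
    (hr : IsSMulRegular M x) : RegLen A (QuotSMulTop x M) t := by
  have := h.nontrivial
  have : Nontrivial (QuotSMulTop x M) := nontrivial_quotSMulTop_of_mem_maximalIdeal M hx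
  rw [RegLen.iff_ext] at h ⊢
  intro i hi
  refine subsingleton_of_forall_eq 0 fun α => ?_
  have h1 := h (i + 1) (by omega)
  have h2 := h i (by omega)
  obtain ⟨β, hβ⟩ := Abelian.Ext.covariant_sequence_exact₃ _
    (IsSMulRegular.smulShortComplex_shortExact (M := ModuleCat.of A M) hr) α rfl
    (@Subsingleton.elim (Abelian.Ext _ (ModuleCat.of A M) (i + 1)) h1 _ _)
  have hβ0 : β = 0 := @Subsingleton.elim (Abelian.Ext _ (ModuleCat.of A M) i) h2 _ _
  rw [← hβ, hβ0]
  exact Abelian.Ext.zero_comp ..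

variable {C : Type} [AddCommGroup C] [Module A C] [Module.Finite A C] [Nontrivial C]


lemma annihilator_le : Module.annihilator A C ≤ IsLocalRing.maximalIdeal A :=
  IsLocalRing.le_maximalIdeal fun h => by
    have := Module.annihilator_eq_top_iff.mp h
    exact not_subsingleton C this

lemma nontrivial_hom {Y : Type} [AddCommGroup Y] [Module A Y] [Module.Finite A Y] [Nontrivial Y]
    (hY : ExtVanish A C Y) : Nontrivial (C →ₗ[A] Y) := by
  by_contra hn
  rw [not_nontrivial_iff_subsingleton] at hn
  have hall : ∀ i, Subsingleton (Abelian.Ext (ModuleCat.of A C) (ModuleCat.of A Y) i) := by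
    intro i
    rcases Nat.eq_zero_or_pos i with rfl | hi
    · exact (Abelian.Ext.addEquiv₀.trans ModuleCat.homAddEquiv).subsingleton
    · exact hY i hi
  obtain ⟨d, hd⟩ : ∃ d : ℕ, Module.supportDim A Y < d := by
    have h1 : Module.supportDim A Y < ⊤ :=
      (Module.supportDim_le_ringKrullDim A Y).trans_lt ringKrullDim_lt_top
    generalize Module.supportDim A Y = z at h1
    induction z with
    | bot => exact ⟨0, WithBot.bot_lt_coe _⟩
    | coe z =>
      induction z with
      | top => exact absurd h1 (lt_irrefl _)
      | coe z => exact ⟨z + 1, by exact_mod_cast Nat.lt_succ_self z⟩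
  obtain ⟨rs, hl, -, hreg⟩ := ModuleCat.exists_isRegular_of_exists_subsingleton_ext
    (Module.annihilator A C) d (ModuleCat.of A Y) (smul_top_lt annihilator_le)
    (ModuleCat.of A C) Module.support_eq_zeroLocus (fun i _ => hall i)
  have := Module.supportDim_add_length_eq_supportDim_of_isRegular rs hreg
  rw [hl] at this
  have hnt : Nontrivial (Y ⧸ Ideal.ofList rs • (⊤ : Submodule A Y)) :=
    hreg.quot_ofList_smul_nontrivial ⊤
  have hne := (Module.supportDim_ne_bot_iff_nontrivial A _).mpr hnt
  have hle : (d : WithBot ℕ∞) ≤ Module.supportDim A Y := by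
    rw [← show _ = Module.supportDim A Y from this]
    change _ ≤ Module.supportDim A (Y ⧸ Ideal.ofList rs • (⊤ : Submodule A Y)) + _
    generalize Module.supportDim A (Y ⧸ Ideal.ofList rs • (⊤ : Submodule A Y)) = z at hne
    induction z with
    | bot => exact absurd rfl hne
    | coe z => exact_mod_cast le_add_self
  exact absurd hd (not_lt.mpr hle)

/-- if `Hom(C,Y)` has a regular element in the maximal ideal then so does `Y`. -/
lemma exists_regular {Y : Type} [AddCommGroup Y] [Module A Y] [Module.Finite A Y]
    {x : A} (hx : x ∈ IsLocalRing.maximalIdeal A) (hr : IsSMulRegular (C →ₗ[A] Y) x) :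
    ∃ y ∈ IsLocalRing.maximalIdeal A, IsSMulRegular Y y := by
  let m := IsLocalRing.maximalIdeal A
  have hnt : Nontrivial (C ⧸ m • (⊤ : Submodule A C)) :=
    Submodule.Quotient.nontrivial_iff.mpr (smul_top_lt le_rfl).ne
  have hann : Module.annihilator A (C ⧸ m • (⊤ : Submodule A C)) ≤ m := annihilator_le
  -- `C/mC` maps trivially to `Y`, because such maps are killed by `x`
  have hs : Subsingleton ((C ⧸ m • (⊤ : Submodule A C)) →ₗ[A] Y) := by
    refine subsingleton_of_forall_eq 0 fun f => ?_
    have h0 : f.comp (Submodule.mkQ _) = 0 := by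
      apply hr
      ext c
      have : x • (Submodule.mkQ (m • (⊤ : Submodule A C)) c) = 0 := by
        rw [← map_smul]
        exact (Submodule.Quotient.mk_eq_zero _).mpr (Submodule.smul_mem_smul hx trivial)
      simp only [LinearMap.smul_apply, LinearMap.comp_apply, LinearMap.zero_apply, smul_zero]
      rw [← map_smul, this, map_zero]
    ext c
    exact LinearMap.congr_fun h0 c
  obtain ⟨y, hy, hy'⟩ := IsSMulRegular.subsingleton_linearMap_iff.mp hs
  exact ⟨y, hann hy, hy'⟩

lemma regLen_hom_iff (t : ℕ) : ∀ (Y : Type) [AddCommGroup Y] [Module A Y] [Module.Finite A Y],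
    ExtVanish A C Y → (RegLen A Y t ↔ RegLen A (C →ₗ[A] Y) t) := by
  induction t with
  | zero =>
    intro Y _ _ _ hY
    constructor
    · intro h
      have := h.nontrivial
      have := nontrivial_hom hY
      exact ⟨[], rfl, by simp, RingTheory.Sequence.IsRegular.nil _ _⟩
    · intro h
      have := h.nontrivial
      have : Nontrivial Y := by
        by_contra hn
        rw [not_nontrivial_iff_subsingleton] at hn
        exact not_subsingleton (C →ₗ[A] Y) inferInstance
      exact ⟨[], rfl, by simp, RingTheory.Sequence.IsRegular.nil _ _⟩
  | succ t ih =>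
    intro Y _ _ _ hY
    have key : ∀ x : A, IsSMulRegular Y x →
        (RegLen A (QuotSMulTop x Y) t ↔ RegLen A (QuotSMulTop x (C →ₗ[A] Y)) t) := by
      intro x hx
      obtain ⟨e⟩ := nonempty_quotHom hY hx
      rw [RegLen.congr e]
      exact ih (QuotSMulTop x Y) (extVanish_quotSMulTop hY hx)
    constructor
    · intro h
      obtain ⟨x, hx, hr, hq⟩ := h.exists_quot
      exact RegLen.cons hx (isSMulRegular_hom hr) ((key x hr).mp hq)
    · intro h
      obtain ⟨x, hx, hr, -⟩ := h.exists_quot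
      obtain ⟨y, hy, hyr⟩ := exists_regular hx hr
      exact RegLen.cons hy hyr ((key y hyr).mpr (h.quot hy (isSMulRegular_hom hyr)))

lemma moduleDepth_hom (Y : Type) [AddCommGroup Y] [Module A Y] [Module.Finite A Y]
    (hY : ExtVanish A C Y) : moduleDepth A Y = moduleDepth A (C →ₗ[A] Y) :=
  congrArg sSup (Set.ext fun t => regLen_hom_iff t Y hY)

end Local

/-- For a semidualizing module `C` over a commutative noetherian local ring `A` one has
`depth C = depth A`, and `depth Y = depth Hom_A(C,Y)` for every finitely generated
module `Y` of finite `C`-dimension. -/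
theorem depth_semidualizing_and_hom
    (A : Type) [CommRing A] [IsNoetherianRing A] [IsLocalRing A]
    (C : Type) [AddCommGroup C] [Module A C] [Module.Finite A C]
    (hC : IsSemidualizing A C) :
    moduleDepth A C = moduleDepth A A ∧
    ∀ (Y : Type) [AddCommGroup Y] [Module A Y] [Module.Finite A Y],
      HasFiniteCDim A C Y → moduleDepth A Y = moduleDepth A (C →ₗ[A] Y) := by
  obtain ⟨hbij, hext⟩ := hC
  have hpi := extVanish_pi_of_old hext
  have hnt : Nontrivial C := by
    by_contra hn
    rw [not_nontrivial_iff_subsingleton] at hn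
    exact zero_ne_one (hbij.1 (LinearMap.ext fun c => Subsingleton.elim _ _) : (0 : A) = 1)
  have hY : ∀ (Y : Type) [AddCommGroup Y] [Module A Y] [Module.Finite A Y],
      HasFiniteCDim A C Y → moduleDepth A Y = moduleDepth A (C →ₗ[A] Y) := by
    intro Y _ _ _ ⟨s, n, d, ε, hn, hε, h0, hd⟩
    exact moduleDepth_hom Y (extVanish_of_resolution hpi (s + 1) Y n d ε
      (fun i hi => hn i (by omega)) hε h0 hd)
  refine ⟨?_, hY⟩
  have hCC : ExtVanish A C C := by
    let e : (Fin 1 → C) ≃ₗ[A] C := LinearEquiv.funUnique (Fin 1) A C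
    refine extVanish_of_surjective e.toLinearMap e.surjective (hpi 1) ?_
    have : Subsingleton (LinearMap.ker e.toLinearMap) := by
      rw [LinearEquiv.ker]; infer_instance
    exact extVanish_of_subsingleton
  rw [moduleDepth_hom C hCC]
  let e : A ≃ₗ[A] (C →ₗ[A] C) :=
    LinearEquiv.ofBijective (Algebra.linearMap A (Module.End A C)) hbij
  exact congrArg sSup (Set.ext fun t => (RegLen.congr e t).symm)
end
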